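/- Let γ > 0, ρ > 0, C_V > 0, and fix (V^k, U^k, s^k, w^k). Suppose V^{k+1} minimizes V ↦ g(V, U^k, s^k), suppose ‖V^{k+1}‖_F² ≤ C_V, and suppose U^{k+1} minimizes U ↦ ⟨U − U^k, ∇_U g(V^{k+1},U^k,s^k)⟩_F + (1/(2γ))‖U − U^k‖_F² + (ρ/2)‖(1/m)Uᵀ𝟙 − s^k + w^k‖₂² − (ρ/2)‖w^k‖₂². Then L_ρ(V^{k+1}, U^{k+1}, s^k, w^k) − L_ρ(V^k, U^k, s^k, w^k) ≤ ((√m((1+α₀)C_V + λ̄_U) − 1/γ)/2) · ‖U^{k+1} − U^k‖_F² − (λ̲_V/2) · ‖V^{k+1} − V^k‖_F². -/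

import Mathlib

open Matrix Finset Filter Topology

noncomputable section

/-- Squared Frobenius norm of a real matrix. -/
def frobSq {a b : ℕ} (A : Matrix (Fin a) (Fin b) ℝ) : ℝ := ∑ i, ∑ j, (A i j) ^ 2

/-- Frobenius norm of a real matrix. -/
def frobNorm {a b : ℕ} (A : Matrix (Fin a) (Fin b) ℝ) : ℝ := Real.sqrt (frobSq A)

/-- Frobenius (trace) inner product of matrices. -/
def frobInner {a b : ℕ} (A B : Matrix (Fin a) (Fin b) ℝ) : ℝ := ∑ i, ∑ j, A i j * B i j

/-- Squared Euclidean norm of a vector. -/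
def vecSq {a : ℕ} (x : Fin a → ℝ) : ℝ := ∑ i, (x i) ^ 2

/-- Euclidean norm of a vector. -/
def vecNorm {a : ℕ} (x : Fin a → ℝ) : ℝ := Real.sqrt (vecSq x)

/-- Entrywise (Hadamard) product of matrices. -/
def hprod {a b : ℕ} (A B : Matrix (Fin a) (Fin b) ℝ) : Matrix (Fin a) (Fin b) ℝ :=
  Matrix.of fun i j => A i j * B i j

/-- The iALS loss L(V,U). -/
def iALSLoss {m n d : ℕ} (R : Matrix (Fin m) (Fin n) ℝ) (α₀ : ℝ)
    (lamU : Fin m → ℝ) (lamV : Fin n → ℝ)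
    (V : Matrix (Fin n) (Fin d) ℝ) (U : Matrix (Fin m) (Fin d) ℝ) : ℝ :=
  (1/2) * frobSq (hprod R (R - U * Vᵀ)) + (α₀/2) * frobSq (U * Vᵀ)
    + (1/2) * ∑ i, lamU i * vecSq (U i) + (1/2) * ∑ j, lamV j * vecSq (V j)

/-- g(V,U,s) = L(V,U) + (λ_ex/2)‖V s‖₂². -/
def gFun {m n d : ℕ} (R : Matrix (Fin m) (Fin n) ℝ) (α₀ lamex : ℝ)
    (lamU : Fin m → ℝ) (lamV : Fin n → ℝ)
    (V : Matrix (Fin n) (Fin d) ℝ) (U : Matrix (Fin m) (Fin d) ℝ) (s : Fin d → ℝ) : ℝ :=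
  iALSLoss R α₀ lamU lamV V U + (lamex/2) * vecSq (V.mulVec s)

/-- (1/m) Uᵀ 𝟙 : the average of the rows of U. -/
def avgRow {m d : ℕ} (U : Matrix (Fin m) (Fin d) ℝ) : Fin d → ℝ :=
  fun k => (1 / (m : ℝ)) * ∑ i, U i k

/-- The augmented Lagrangian L_ρ(V,U,s,w). -/
def augL {m n d : ℕ} (R : Matrix (Fin m) (Fin n) ℝ) (α₀ lamex : ℝ)
    (lamU : Fin m → ℝ) (lamV : Fin n → ℝ) (ρ : ℝ)
    (V : Matrix (Fin n) (Fin d) ℝ) (U : Matrix (Fin m) (Fin d) ℝ) (s w : Fin d → ℝ) : ℝ :=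
  gFun R α₀ lamex lamU lamV V U s + (ρ/2) * vecSq (avgRow U - s + w) - (ρ/2) * vecSq w

/-- Gradient of g with respect to V; the j-th row is
(Σ_i R_{ij} u_i u_iᵀ + α₀ UᵀU + λ_ex s sᵀ + λ_V^{(j)} I) v_j − Σ_i R_{ij} u_i. -/
def gradV {m n d : ℕ} (R : Matrix (Fin m) (Fin n) ℝ) (α₀ lamex : ℝ)
    (lamV : Fin n → ℝ)
    (V : Matrix (Fin n) (Fin d) ℝ) (U : Matrix (Fin m) (Fin d) ℝ) (s : Fin d → ℝ) :
    Matrix (Fin n) (Fin d) ℝ :=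
  Matrix.of fun j =>
    ((∑ i, R i j • vecMulVec (U i) (U i)) + α₀ • (Uᵀ * U)
        + lamex • vecMulVec s s + (lamV j) • (1 : Matrix (Fin d) (Fin d) ℝ)).mulVec (V j)
      - ∑ i, R i j • U i

/-- Gradient of g with respect to U; the i-th row is
(Σ_j R_{ij} v_j v_jᵀ + α₀ VᵀV + λ_U^{(i)} I) u_i − Σ_j R_{ij} v_j (independent of s). -/
def gradU {m n d : ℕ} (R : Matrix (Fin m) (Fin n) ℝ) (α₀ : ℝ)
    (lamU : Fin m → ℝ)
    (V : Matrix (Fin n) (Fin d) ℝ) (U : Matrix (Fin m) (Fin d) ℝ) :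
    Matrix (Fin m) (Fin d) ℝ :=
  Matrix.of fun i =>
    ((∑ j, R i j • vecMulVec (V j) (V j)) + α₀ • (Vᵀ * V)
        + (lamU i) • (1 : Matrix (Fin d) (Fin d) ℝ)).mulVec (U i)
      - ∑ j, R i j • V j

/-- Gradient of g with respect to s: λ_ex VᵀV s (independent of U). -/
def gradS {n d : ℕ} (lamex : ℝ) (V : Matrix (Fin n) (Fin d) ℝ) (s : Fin d → ℝ) : Fin d → ℝ :=
  lamex • (Vᵀ * V).mulVec s

/-- Gradient of the augmented Lagrangian with respect to U. -/
def gradUL {m n d : ℕ} (R : Matrix (Fin m) (Fin n) ℝ) (α₀ : ℝ) (lamU : Fin m → ℝ) (ρ : ℝ)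
    (V : Matrix (Fin n) (Fin d) ℝ) (U : Matrix (Fin m) (Fin d) ℝ) (s w : Fin d → ℝ) :
    Matrix (Fin m) (Fin d) ℝ :=
  Matrix.of fun i => gradU R α₀ lamU V U i + (ρ / (m : ℝ)) • (avgRow U - s + w)

/-- Gradient of the augmented Lagrangian with respect to s:
λ_ex VᵀV s − ρ((1/m)Uᵀ𝟙 − s + w). -/
def gradSL {m n d : ℕ} (lamex ρ : ℝ)
    (V : Matrix (Fin n) (Fin d) ℝ) (U : Matrix (Fin m) (Fin d) ℝ) (s w : Fin d → ℝ) :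
    Fin d → ℝ :=
  gradS lamex V s - ρ • (avgRow U - s + w)

/-- Gradient of the augmented Lagrangian with respect to w: ρ((1/m)Uᵀ𝟙 − s). -/
def gradWL {m d : ℕ} (ρ : ℝ) (U : Matrix (Fin m) (Fin d) ℝ) (s : Fin d → ℝ) : Fin d → ℝ :=
  ρ • (avgRow U - s)

lemma frobSq_nonneg {a b : ℕ} (A : Matrix (Fin a) (Fin b) ℝ) : 0 ≤ frobSq A :=
  Finset.sum_nonneg fun _ _ => Finset.sum_nonneg fun _ _ => sq_nonneg _

lemma vecSq_nonneg {a : ℕ} (x : Fin a → ℝ) : 0 ≤ vecSq x :=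
  Finset.sum_nonneg fun _ _ => sq_nonneg _

lemma frobSq_eq_sum_vecSq {a b : ℕ} (A : Matrix (Fin a) (Fin b) ℝ) :
    frobSq A = ∑ i, vecSq (A i) := rfl

lemma frobSq_neg {a b : ℕ} (A : Matrix (Fin a) (Fin b) ℝ) : frobSq (-A) = frobSq A := by
  simp [frobSq]

/-- Submultiplicativity of the Frobenius norm, for a product `A * Bᵀ`. -/
lemma frobSq_mul_transpose_le {a b c : ℕ} (A : Matrix (Fin a) (Fin c) ℝ)
    (B : Matrix (Fin b) (Fin c) ℝ) : frobSq (A * Bᵀ) ≤ frobSq A * frobSq B := by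
  rw [frobSq_eq_sum_vecSq A, frobSq_eq_sum_vecSq B, Finset.sum_mul_sum]
  refine Finset.sum_le_sum fun i _ => Finset.sum_le_sum fun j _ => ?_
  simpa [Matrix.mul_apply, vecSq] using Finset.sum_mul_sq_le_sq_mul_sq Finset.univ (A i) (B j)

lemma frobSq_add_smul {a b : ℕ} (A B : Matrix (Fin a) (Fin b) ℝ) (t : ℝ) :
    frobSq (A + t • B) = frobSq A + t * (2 * frobInner A B) + t ^ 2 * frobSq B := by
  simp only [frobSq, frobInner, Finset.mul_sum, ← Finset.sum_add_distrib]
  refine Finset.sum_congr rfl fun i _ => Finset.sum_congr rfl fun j _ => ?_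
  simp only [Matrix.add_apply, Matrix.smul_apply, smul_eq_mul]
  ring

lemma vecSq_add_smul {a : ℕ} (x y : Fin a → ℝ) (t : ℝ) :
    vecSq (x + t • y) = vecSq x + t * (2 * x ⬝ᵥ y) + t ^ 2 * vecSq y := by
  simp only [vecSq, dotProduct, Finset.mul_sum, ← Finset.sum_add_distrib]
  refine Finset.sum_congr rfl fun i _ => ?_
  simp only [Pi.add_apply, Pi.smul_apply, smul_eq_mul]
  ring

/-- Along any line in `V`, the function `gFun` is a quadratic polynomial with the displayed
leading coefficient. -/
lemma gFun_add_smul {m n d : ℕ} (R : Matrix (Fin m) (Fin n) ℝ) (α₀ lamex : ℝ)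
    (lamU : Fin m → ℝ) (lamV : Fin n → ℝ) (V D : Matrix (Fin n) (Fin d) ℝ)
    (U : Matrix (Fin m) (Fin d) ℝ) (s : Fin d → ℝ) :
    ∃ b : ℝ, ∀ t : ℝ, gFun R α₀ lamex lamU lamV (V + t • D) U s
      = gFun R α₀ lamex lamU lamV V U s + t * b
        + t ^ 2 * ((1/2) * frobSq (hprod R (U * Dᵀ)) + (α₀/2) * frobSq (U * Dᵀ)
          + (1/2) * ∑ j, lamV j * vecSq (D j) + (lamex/2) * vecSq (D.mulVec s)) := by
  refine ⟨-frobInner (hprod R (R - U * Vᵀ)) (hprod R (U * Dᵀ))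
    + α₀ * frobInner (U * Vᵀ) (U * Dᵀ) + ∑ j, lamV j * (V j ⬝ᵥ D j)
    + lamex * (V.mulVec s ⬝ᵥ D.mulVec s), fun t => ?_⟩
  have h1 : hprod R (R - U * (V + t • D)ᵀ)
      = hprod R (R - U * Vᵀ) + (-t) • hprod R (U * Dᵀ) := by
    ext i j
    simp only [hprod, Matrix.of_apply, Matrix.sub_apply, Matrix.add_apply, Matrix.smul_apply,
      Matrix.transpose_add, Matrix.transpose_smul, Matrix.mul_add, Matrix.mul_smul, smul_eq_mul]
    ring
  have h2 : U * (V + t • D)ᵀ = U * Vᵀ + t • (U * Dᵀ) := by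
    rw [Matrix.transpose_add, Matrix.transpose_smul, Matrix.mul_add, Matrix.mul_smul]
  have h3 : (V + t • D).mulVec s = V.mulVec s + t • D.mulVec s := by
    rw [Matrix.add_mulVec, Matrix.smul_mulVec]
  have h4 : ∑ j, lamV j * vecSq ((V + t • D) j) = ∑ j, lamV j * vecSq (V j)
      + t * (2 * ∑ j, lamV j * (V j ⬝ᵥ D j)) + t ^ 2 * ∑ j, lamV j * vecSq (D j) := by
    simp only [Finset.mul_sum, ← Finset.sum_add_distrib]
    refine Finset.sum_congr rfl fun j _ => ?_
    rw [show (V + t • D) j = V j + t • D j from rfl, vecSq_add_smul]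
    ring
  simp only [gFun, iALSLoss]
  rw [h1, h2, h3, h4, frobSq_add_smul, frobSq_add_smul, vecSq_add_smul]
  ring

/-- If `t * b + t ^ 2 * c` is nonnegative for all `t`, then its linear coefficient vanishes. -/
lemma eq_zero_of_forall_quadratic_nonneg {b c : ℝ} (h : ∀ t : ℝ, 0 ≤ t * b + t ^ 2 * c) :
    b = 0 := by
  have hd := discrim_le_zero (a := c) (b := b) (c := 0) fun t => by nlinarith [h t]
  rw [discrim] at hd
  nlinarith

/-- Quadratic growth of `gFun` in `V` around a minimizer. -/
lemma gFun_quadratic_growth {m n d : ℕ} {R : Matrix (Fin m) (Fin n) ℝ} {α₀ lamex : ℝ}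
    (hα : 0 ≤ α₀) (hlamex : 0 ≤ lamex) {lamU : Fin m → ℝ} {lamV : Fin n → ℝ} {μ : ℝ}
    (hμ : ∀ j, μ ≤ lamV j) {V : Matrix (Fin n) (Fin d) ℝ} {U : Matrix (Fin m) (Fin d) ℝ}
    {s : Fin d → ℝ}
    (hV : ∀ V' : Matrix (Fin n) (Fin d) ℝ,
      gFun R α₀ lamex lamU lamV V U s ≤ gFun R α₀ lamex lamU lamV V' U s)
    (V' : Matrix (Fin n) (Fin d) ℝ) :
    gFun R α₀ lamex lamU lamV V U s + (μ/2) * frobSq (V' - V)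
      ≤ gFun R α₀ lamex lamU lamV V' U s := by
  obtain ⟨b, hb⟩ := gFun_add_smul R α₀ lamex lamU lamV V (V' - V) U s
  have hb0 : b = 0 := eq_zero_of_forall_quadratic_nonneg fun t => by
    have h := hV (V + t • (V' - V))
    rw [hb t, add_assoc, le_add_iff_nonneg_right] at h
    exact h
  have h1 := hb 1
  rw [one_smul, add_sub_cancel, hb0] at h1
  have hw : μ * frobSq (V' - V) ≤ ∑ j, lamV j * vecSq ((V' - V) j) := by
    rw [frobSq_eq_sum_vecSq, Finset.mul_sum]
    exact Finset.sum_le_sum fun j _ => mul_le_mul_of_nonneg_right (hμ j) (vecSq_nonneg _)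
  have hR := frobSq_nonneg (hprod R (U * (V' - V)ᵀ))
  have hA := mul_nonneg hα (frobSq_nonneg (U * (V' - V)ᵀ))
  have hE := mul_nonneg hlamex (vecSq_nonneg ((V' - V).mulVec s))
  linarith

lemma dotProduct_gradU {m n d : ℕ} (R : Matrix (Fin m) (Fin n) ℝ) (α₀ : ℝ) (lamU : Fin m → ℝ)
    (V : Matrix (Fin n) (Fin d) ℝ) (U : Matrix (Fin m) (Fin d) ℝ) (x : Fin d → ℝ) (i : Fin m) :
    x ⬝ᵥ gradU R α₀ lamU V U i
      = ∑ j, (R i j * (x ⬝ᵥ V j) * (U i ⬝ᵥ V j - 1) + α₀ * (x ⬝ᵥ V j) * (U i ⬝ᵥ V j))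
        + lamU i * (x ⬝ᵥ U i) := by
  have hV : x ⬝ᵥ (Vᵀ * V).mulVec (U i) = ∑ j, (x ⬝ᵥ V j) * (U i ⬝ᵥ V j) := by
    rw [← Matrix.mulVec_mulVec, Matrix.dotProduct_mulVec, Matrix.vecMul_transpose]
    refine Finset.sum_congr rfl fun j _ => ?_
    rw [dotProduct_comm x, dotProduct_comm (U i)]
    rfl
  have hrow : gradU R α₀ lamU V U i
      = ((∑ j, R i j • vecMulVec (V j) (V j)) + α₀ • (Vᵀ * V)
        + lamU i • (1 : Matrix (Fin d) (Fin d) ℝ)).mulVec (U i) - ∑ j, R i j • V j := rfl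
  simp only [hrow, dotProduct_sub, Matrix.add_mulVec, Matrix.sum_mulVec,
    Matrix.smul_mulVec, Matrix.one_mulVec, dotProduct_add, dotProduct_sum, dotProduct_smul,
    Matrix.vecMulVec_mulVec, smul_eq_mul, hV, op_smul_eq_smul]
  rw [Finset.mul_sum, add_sub_right_comm, add_sub_right_comm, ← Finset.sum_sub_distrib,
    ← Finset.sum_add_distrib]
  congr 1
  refine Finset.sum_congr rfl fun j _ => ?_
  rw [dotProduct_comm (V j) (U i)]
  ring

/-- Exact second-order expansion of `gFun` in `U`, for a binary matrix `R`. -/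
lemma gFun_add_right {m n d : ℕ} {R : Matrix (Fin m) (Fin n) ℝ}
    (hR : ∀ i j, R i j = 0 ∨ R i j = 1) (α₀ lamex : ℝ)
    (lamU : Fin m → ℝ) (lamV : Fin n → ℝ) (V : Matrix (Fin n) (Fin d) ℝ)
    (U D : Matrix (Fin m) (Fin d) ℝ) (s : Fin d → ℝ) :
    gFun R α₀ lamex lamU lamV V (U + D) s
      = gFun R α₀ lamex lamU lamV V U s + frobInner D (gradU R α₀ lamU V U)
        + ((1/2) * frobSq (hprod R (D * Vᵀ)) + (α₀/2) * frobSq (D * Vᵀ)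
          + (1/2) * ∑ i, lamU i * vecSq (D i)) := by
  have hI : frobInner D (gradU R α₀ lamU V U) = ∑ i, D i ⬝ᵥ gradU R α₀ lamU V U i := rfl
  have hmul (A : Matrix (Fin m) (Fin d) ℝ) (i : Fin m) (j : Fin n) :
      (A * Vᵀ) i j = A i ⬝ᵥ V j := rfl
  have hU (i : Fin m) : vecSq (U i + D i) = vecSq (U i) + 2 * (D i ⬝ᵥ U i) + vecSq (D i) := by
    rw [dotProduct_comm]
    simpa using vecSq_add_smul (U i) (D i) 1
  rw [hI]
  simp only [dotProduct_gradU, gFun, iALSLoss, frobSq, hprod, Matrix.of_apply, Matrix.sub_apply,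
    hmul, show ∀ i, (U + D) i = U i + D i from fun _ => rfl, hU, add_dotProduct]
  have key (i : Fin m) (j : Fin n) :
      1/2 * (R i j * (R i j - (U i ⬝ᵥ V j + D i ⬝ᵥ V j))) ^ 2
          + α₀/2 * (U i ⬝ᵥ V j + D i ⬝ᵥ V j) ^ 2
        = 1/2 * (R i j * (R i j - U i ⬝ᵥ V j)) ^ 2 + α₀/2 * (U i ⬝ᵥ V j) ^ 2
          + (R i j * (D i ⬝ᵥ V j) * (U i ⬝ᵥ V j - 1) + α₀ * (D i ⬝ᵥ V j) * (U i ⬝ᵥ V j))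
          + (1/2 * (R i j * (D i ⬝ᵥ V j)) ^ 2 + α₀/2 * (D i ⬝ᵥ V j) ^ 2) := by
    rcases hR i j with h | h <;> rw [h] <;> ring
  have hsum := Finset.sum_congr (rfl : (Finset.univ : Finset (Fin m)) = Finset.univ)
    fun i _ => Finset.sum_congr (rfl : (Finset.univ : Finset (Fin n)) = Finset.univ)
    fun j _ => key i j
  simp only [mul_add, Finset.sum_add_distrib, ← Finset.mul_sum, mul_left_comm _ (2 : ℝ)]
    at hsum ⊢
  linarith

/-- Upper bound for the second-order term of `gFun` in `U`. -/
lemma gFun_le_of_frobSq_le {m n d : ℕ} {R : Matrix (Fin m) (Fin n) ℝ}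
    (hR : ∀ i j, R i j = 0 ∨ R i j = 1) {α₀ : ℝ} (hα : 0 ≤ α₀) (lamex : ℝ)
    {lamU : Fin m → ℝ} (lamV : Fin n → ℝ) {M C : ℝ} (hM : ∀ i, lamU i ≤ M)
    {V : Matrix (Fin n) (Fin d) ℝ} (hV : frobSq V ≤ C) (U U' : Matrix (Fin m) (Fin d) ℝ)
    (s : Fin d → ℝ) :
    gFun R α₀ lamex lamU lamV V U' s
      ≤ gFun R α₀ lamex lamU lamV V U s + frobInner (U' - U) (gradU R α₀ lamU V U)
        + (((1 + α₀) * C + M)/2) * frobSq (U' - U) := by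
  have hexp := gFun_add_right hR α₀ lamex lamU lamV V U (U' - U) s
  rw [add_sub_cancel] at hexp
  set D := U' - U
  have hprod_le : frobSq (hprod R (D * Vᵀ)) ≤ frobSq (D * Vᵀ) := by
    refine Finset.sum_le_sum fun i _ => Finset.sum_le_sum fun j _ => ?_
    rcases hR i j with h | h <;> simp [hprod, h, sq_nonneg]
  have hDV : frobSq (D * Vᵀ) ≤ C * frobSq D :=
    (frobSq_mul_transpose_le D V).trans <| by
      rw [mul_comm]
      exact mul_le_mul_of_nonneg_right hV (frobSq_nonneg D)
  have hw : ∑ i, lamU i * vecSq (D i) ≤ M * frobSq D := by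
    rw [frobSq_eq_sum_vecSq, Finset.mul_sum]
    exact Finset.sum_le_sum fun i _ => mul_le_mul_of_nonneg_right (hM i) (vecSq_nonneg _)
  have hαDV := mul_le_mul_of_nonneg_left hDV hα
  linarith

/-- Lemma on the V and U updates. -/
theorem VU_update_decrease {m n d : ℕ} (hm : 1 ≤ m) (hn : 1 ≤ n) (hd : 1 ≤ d)
    (R : Matrix (Fin m) (Fin n) ℝ) (hR : ∀ i j, R i j = 0 ∨ R i j = 1)
    (α₀ lamex ρ γ : ℝ) (hα : 0 < α₀) (hlamex : 0 < lamex) (hρ0 : 0 < ρ) (hγ0 : 0 < γ)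
    (lamU : Fin m → ℝ) (lamV : Fin n → ℝ)
    (hlamU : ∀ i, 0 < lamU i) (hlamV : ∀ j, 0 < lamV j)
    (lamUbar lamVlow : ℝ)
    (hUbar : IsGreatest (Set.range lamU) lamUbar)
    (hVlow : IsLeast (Set.range lamV) lamVlow)
    (CV : ℝ) (hCV : 0 < CV)
    (Vk Vk1 : Matrix (Fin n) (Fin d) ℝ) (Uk Uk1 : Matrix (Fin m) (Fin d) ℝ)
    (sk wk : Fin d → ℝ)
    (hVmin : ∀ V' : Matrix (Fin n) (Fin d) ℝ,
      gFun R α₀ lamex lamU lamV Vk1 Uk sk ≤ gFun R α₀ lamex lamU lamV V' Uk sk)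
    (hVk1b : frobSq Vk1 ≤ CV)
    (hUmin : ∀ U' : Matrix (Fin m) (Fin d) ℝ,
      frobInner (Uk1 - Uk) (gradU R α₀ lamU Vk1 Uk)
          + (1/(2*γ)) * frobSq (Uk1 - Uk)
          + (ρ/2) * vecSq (avgRow Uk1 - sk + wk) - (ρ/2) * vecSq wk
        ≤ frobInner (U' - Uk) (gradU R α₀ lamU Vk1 Uk)
          + (1/(2*γ)) * frobSq (U' - Uk)
          + (ρ/2) * vecSq (avgRow U' - sk + wk) - (ρ/2) * vecSq wk) :
    augL R α₀ lamex lamU lamV ρ Vk1 Uk1 sk wk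
        - augL R α₀ lamex lamU lamV ρ Vk Uk sk wk
      ≤ ((Real.sqrt m * ((1 + α₀) * CV + lamUbar) - 1/γ) / 2) * frobSq (Uk1 - Uk)
        - (lamVlow / 2) * frobSq (Vk1 - Vk) := by
  have hV := gFun_quadratic_growth hα.le hlamex.le (fun j => hVlow.2 ⟨j, rfl⟩) hVmin Vk
  have hU := gFun_le_of_frobSq_le hR hα.le lamex lamV (fun i => hUbar.2 ⟨i, rfl⟩) hVk1b Uk Uk1 sk
  have hprox := hUmin Uk
  have hzero : frobSq (0 : Matrix (Fin m) (Fin d) ℝ) = 0 := by simp [frobSq]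
  have hinner : frobInner 0 (gradU R α₀ lamU Vk1 Uk) = 0 := by simp [frobInner]
  rw [sub_self, hzero, hinner] at hprox
  have hsym : frobSq (Vk - Vk1) = frobSq (Vk1 - Vk) := by rw [← frobSq_neg, neg_sub]
  rw [hsym] at hV
  have hγ : 1/(2*γ) = 1/γ/2 := by field_simp
  rw [hγ] at hprox
  obtain ⟨i, hi⟩ := hUbar.1
  have hbar : 0 < lamUbar := hi ▸ hlamU i
  have hL : 0 ≤ (1 + α₀) * CV + lamUbar := by positivity
  have hsqrt : 1 ≤ Real.sqrt m := Real.one_le_sqrt.2 (by exact_mod_cast hm)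
  have hLm := mul_le_mul_of_nonneg_right (le_mul_of_one_le_left hL hsqrt) (frobSq_nonneg (Uk1 - Uk))
  simp only [augL]
  linarith
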